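/- Let λ be a partition with λ₁ + ℓ(λ) − 1 ≤ k (i.e., the hook-length of the corner cell of λ is at most k). Then the principal order ideal of λ in the k-Young order coincides with that in Young's lattice: for all partitions μ and all partitions ν with ν ⊆ λ, one has μ ≼ ν in the k-Young order if and only if μ ⊆ ν. -/

import Mathlib

/-- A partition: a weakly decreasing list of positive integers. -/
def IsPartition (l : List ℕ) : Prop :=
  l.Pairwise (· ≥ ·) ∧ ∀ x ∈ l, 0 < x

/-- The `i`-th part (0-indexed), with parts beyond the length equal to 0. -/
def part (l : List ℕ) (i : ℕ) : ℕ := l.getD i 0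

/-- Diagram containment `l ⊆ m`: every part of `l` is at most the corresponding part of `m`. -/
def SubDiag (l m : List ℕ) : Prop := ∀ i, part l i ≤ part m i

/-- A `k`-bounded partition: a partition whose first part is at most `k`. -/
def KBounded (k : ℕ) (l : List ℕ) : Prop := IsPartition l ∧ part l 0 ≤ k

/-- Hook length of the square `(i,j)` (0-indexed) with respect to the skew diagram
`outer/inner`: the number of cells `(i,j')` of the skew diagram with `j' ≥ j` plus the
number of cells `(i',j)` of the skew diagram with `i' > i`. -/
def hookLen (outer inner : List ℕ) (i j : ℕ) : ℕ :=
  ((Finset.range (part outer i)).filter (fun j' => j ≤ j' ∧ part inner i ≤ j')).card +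
  ((Finset.range outer.length).filter
    (fun i' => i < i' ∧ part inner i' ≤ j ∧ j < part outer i')).card

/-- `(outer, inner)` is the `k`-skew diagram of the `k`-bounded partition `l`:
row `i` of `outer/inner` has `l i` cells, every cell of `outer/inner` has hook length
at most `k`, and every square of the inner shape has hook length exceeding `k`. -/
def IsKSkew (k : ℕ) (l outer inner : List ℕ) : Prop :=
  IsPartition outer ∧ IsPartition inner ∧ SubDiag inner outer ∧
  (∀ i, part outer i - part inner i = part l i) ∧
  (∀ i j, part inner i ≤ j → j < part outer i → hookLen outer inner i j ≤ k) ∧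
  (∀ i j, j < part inner i → k < hookLen outer inner i j)

/-- Length of column `j` of the skew diagram `outer/inner`. -/
def colLen (outer inner : List ℕ) (j : ℕ) : ℕ :=
  ((Finset.range outer.length).filter
    (fun i => part inner i ≤ j ∧ j < part outer i)).card

/-- The list of column lengths of the skew diagram `outer/inner`. -/
def skewCols (outer inner : List ℕ) : List ℕ :=
  ((List.range (part outer 0)).map (colLen outer inner)).filter (fun x => decide (x ≠ 0))

/-- The `k`-conjugate of `l`: the partition whose parts are the column lengths of the
(unique) `k`-skew diagram of `l`. -/
noncomputable def kConj (k : ℕ) (l : List ℕ) : List ℕ :=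
  haveI := Classical.dec (∃ p : List ℕ × List ℕ, IsKSkew k l p.1 p.2)
  if h : ∃ p : List ℕ × List ℕ, IsKSkew k l p.1 p.2 then
    skewCols h.choose.1 h.choose.2
  else []

/-- The covering relation of the `k`-Young order on `k`-bounded partitions. -/
def KCover (k : ℕ) (l m : List ℕ) : Prop :=
  KBounded k l ∧ KBounded k m ∧ SubDiag l m ∧
  SubDiag (kConj k l) (kConj k m) ∧ m.sum = l.sum + 1

/-- The `k`-Young order: reflexive-transitive closure of the covering relation. -/
def KLe (k : ℕ) : List ℕ → List ℕ → Prop := Relation.ReflTransGen (KCover k)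

/-- The weakly decreasing rearrangement of the combined parts of two partitions. -/
def punion (l r : List ℕ) : List ℕ := (l ++ r).mergeSort (fun a b => decide (a ≥ b))

/-- The ordinary conjugate of a partition: the list of column lengths of its diagram. -/
def conj (l : List ℕ) : List ℕ :=
  (List.range (part l 0)).map (fun j => (l.filter (fun x => decide (j < x))).length)

theorem part_nil (i : ℕ) : part [] i = 0 := by simp [part]

theorem part_cons_zero (a : ℕ) (l : List ℕ) : part (a :: l) 0 = a := by simp [part]

theorem part_cons_succ (a : ℕ) (l : List ℕ) (i : ℕ) : part (a :: l) (i + 1) = part l i := by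
  simp [part]

theorem part_of_lt {l : List ℕ} {i : ℕ} (h : i < l.length) : part l i = l[i] := by
  simp [part, h]

theorem part_of_length_le {l : List ℕ} {i : ℕ} (h : l.length ≤ i) : part l i = 0 := by
  simp [part, h]

theorem IsPartition.part_pos_iff {l : List ℕ} (hl : IsPartition l) (i : ℕ) :
    0 < part l i ↔ i < l.length := by
  constructor
  · intro h
    by_contra hi
    rw [part_of_length_le (not_lt.mp hi)] at h
    exact lt_irrefl 0 h
  · intro h
    rw [part_of_lt h]
    exact hl.2 _ (List.getElem_mem h)

theorem IsPartition.part_antitone {l : List ℕ} (hl : IsPartition l) : Antitone (part l) := by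
  intro i j hij
  rcases lt_or_ge j l.length with hj | hj
  · rw [part_of_lt hj, part_of_lt (hij.trans_lt hj)]
    rcases hij.eq_or_lt with rfl | hlt
    · exact le_rfl
    · exact List.pairwise_iff_getElem.mp hl.1 i j _ hj hlt
  · rw [part_of_length_le hj]
    exact Nat.zero_le _

theorem SubDiag.length_le {l m : List ℕ} (h : SubDiag l m) (hl : IsPartition l) :
    l.length ≤ m.length := by
  by_contra! hlt
  have h₁ := (hl.part_pos_iff m.length).mpr hlt
  have h₂ := h m.length
  rw [part_of_length_le le_rfl] at h₂
  omega

theorem SubDiag.trans {l m n : List ℕ} (h : SubDiag l m) (h' : SubDiag m n) : SubDiag l n :=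
  fun i => (h i).trans (h' i)

theorem IsPartition.eq_of_part_eq {l m : List ℕ} (hl : IsPartition l) (hm : IsPartition m)
    (h : ∀ i, part l i = part m i) : l = m := by
  have hlen : l.length = m.length :=
    le_antisymm (SubDiag.length_le (fun i => (h i).le) hl)
      (SubDiag.length_le (fun i => (h i).ge) hm)
  refine List.ext_getElem hlen fun i h₁ h₂ => ?_
  rw [← part_of_lt h₁, ← part_of_lt h₂, h i]

theorem isPartition_nil : IsPartition [] := by simp [IsPartition]

theorem isPartition_cons_iff (a : ℕ) (l : List ℕ) :
    IsPartition (a :: l) ↔ 0 < a ∧ part l 0 ≤ a ∧ IsPartition l := by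
  constructor
  · intro h
    refine ⟨h.2 a (by simp), ?_, h.1.of_cons, fun x hx => h.2 x (by simp [hx])⟩
    simpa [part_cons_zero, part_cons_succ] using h.part_antitone (Nat.zero_le 1)
  · rintro ⟨ha, hla, hl⟩
    refine ⟨List.pairwise_cons.mpr ⟨fun x hx => ?_, hl.1⟩, ?_⟩
    · obtain ⟨i, hi, rfl⟩ := List.getElem_of_mem hx
      rw [← part_of_lt hi]
      exact (hl.part_antitone (Nat.zero_le i)).trans hla
    · intro x hx
      rcases List.mem_cons.mp hx with rfl | hx
      · exact ha
      · exact hl.2 x hx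

theorem subDiag_cons_iff (a b : ℕ) (l m : List ℕ) :
    SubDiag (a :: l) (b :: m) ↔ a ≤ b ∧ SubDiag l m := by
  constructor
  · intro h
    exact ⟨by simpa [part_cons_zero] using h 0,
      fun i => by simpa [part_cons_succ] using h (i + 1)⟩
  · rintro ⟨hab, h⟩ (_ | i)
    · simpa [part_cons_zero] using hab
    · simpa [part_cons_succ] using h i

theorem SubDiag.sum_le {l m : List ℕ} (hl : IsPartition l) (h : SubDiag l m) :
    l.sum ≤ m.sum := by
  induction m generalizing l with
  | nil =>
    have := h.length_le hl
    simp_all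
  | cons b m ih =>
    cases l with
    | nil => simp
    | cons a l =>
      rw [subDiag_cons_iff] at h
      rw [isPartition_cons_iff] at hl
      have := ih hl.2.2 h.2
      simp only [List.sum_cons]
      omega

/-- If `l ⊊ m` in Young's lattice, then `l` has a cover contained in `m`. -/
theorem SubDiag.exists_cover {l m : List ℕ} (hl : IsPartition l) (hm : IsPartition m)
    (h : SubDiag l m) (hne : l ≠ m) :
    ∃ r, IsPartition r ∧ SubDiag l r ∧ SubDiag r m ∧ r.sum = l.sum + 1 := by
  induction m generalizing l with
  | nil =>
    have := h.length_le hl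
    simp_all
  | cons b m ih =>
    rw [isPartition_cons_iff] at hm
    cases l with
    | nil =>
      refine ⟨[1], by simp [IsPartition], fun i => by simp [part_nil], ?_, by simp⟩
      rw [subDiag_cons_iff]
      exact ⟨hm.1, fun i => by simp [part_nil]⟩
    | cons a l =>
      rw [subDiag_cons_iff] at h
      rw [isPartition_cons_iff] at hl
      rcases h.1.eq_or_lt with rfl | hlt
      · obtain ⟨r, hr, hlr, hrm, hsum⟩ := ih hl.2.2 hm.2.2 h.2 (by simpa using hne)
        refine ⟨a :: r, ?_, ?_, ?_, ?_⟩
        · rw [isPartition_cons_iff]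
          exact ⟨hl.1, (hrm 0).trans hm.2.1, hr⟩
        · rw [subDiag_cons_iff]
          exact ⟨le_rfl, hlr⟩
        · rw [subDiag_cons_iff]
          exact ⟨le_rfl, hrm⟩
        · simp only [List.sum_cons]
          omega
      · refine ⟨(a + 1) :: l, ?_, ?_, ?_, ?_⟩
        · rw [isPartition_cons_iff]
          exact ⟨by omega, by omega, hl.2.2⟩
        · rw [subDiag_cons_iff]
          exact ⟨by omega, fun _ => le_rfl⟩
        · rw [subDiag_cons_iff]
          exact ⟨hlt, h.2⟩
        · simp only [List.sum_cons]
          omega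

theorem part_zero_le_of_hook_le {k : ℕ} {l : List ℕ} (h : part l 0 + l.length - 1 ≤ k) :
    part l 0 ≤ k := by
  cases l with
  | nil => simp [part_nil]
  | cons a l =>
    simp only [List.length_cons] at h
    omega

/-- If the corner hook is at most `k`, the straight shape is a `k`-skew diagram. -/
theorem isKSkew_self {k : ℕ} {l : List ℕ} (hl : IsPartition l)
    (hk : part l 0 + l.length - 1 ≤ k) : IsKSkew k l l [] := by
  refine ⟨hl, isPartition_nil, fun i => by simp [part_nil], fun i => by simp [part_nil], ?_,
    fun i j hj => by simp [part_nil] at hj⟩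
  intro i j _ hj
  have hi : i < l.length := (hl.part_pos_iff i).mp (by omega)
  have harm := (Finset.card_filter_le (Finset.range (part l i))
    (fun j' => j ≤ j' ∧ part [] i ≤ j')).trans_eq (Finset.card_range _)
  have hleg : ((Finset.range l.length).filter
      (fun i' => i < i' ∧ part [] i' ≤ j ∧ j < part l i')).card ≤ l.length - 1 := by
    rw [← Nat.sub_zero (l.length - 1), ← Nat.card_Ioc]
    refine Finset.card_le_card fun i' hi' => ?_
    simp only [Finset.mem_filter, Finset.mem_range] at hi'
    exact Finset.mem_Ioc.mpr (by omega)
  have := hl.part_antitone (Nat.zero_le i)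
  unfold hookLen
  omega

/-- If the corner hook of `l` is at most `k`, the straight shape is its only `k`-skew diagram. -/
theorem IsKSkew.eq_of_hook_le {k : ℕ} {l outer inner : List ℕ} (hl : IsPartition l)
    (hk : part l 0 + l.length - 1 ≤ k) (h : IsKSkew k l outer inner) :
    outer = l ∧ inner = [] := by
  obtain ⟨ho, hi, hsub, hrow, -, hlong⟩ := h
  have hinner : inner = [] := by
    by_contra hne
    have hpos : 0 < inner.length := List.length_pos_iff.mpr hne
    have hlen := hsub.length_le hi
    set r := inner.length - 1 with hr
    have hlt := hlong r 0 ((hi.part_pos_iff r).mpr (by omega))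
    have harm : ((Finset.range (part outer r)).filter
        (fun j' => 0 ≤ j' ∧ part inner r ≤ j')).card ≤ part l r := by
      rw [← hrow r, ← Nat.card_Ico]
      refine Finset.card_le_card fun j hj => ?_
      simp only [Finset.mem_filter, Finset.mem_range] at hj
      exact Finset.mem_Ico.mpr ⟨hj.2.2, hj.1⟩
    have hleg : ((Finset.range outer.length).filter
        (fun i' => r < i' ∧ part inner i' ≤ 0 ∧ 0 < part outer i')).card ≤ l.length - 1 - r := by
      rw [← Nat.card_Ioc]
      refine Finset.card_le_card fun i' hi' => ?_
      simp only [Finset.mem_filter, Finset.mem_range] at hi'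
      have hlen' : i' < l.length := (hl.part_pos_iff i').mp (by rw [← hrow i']; omega)
      exact Finset.mem_Ioc.mpr (by omega)
    have hanti := hl.part_antitone (Nat.zero_le r)
    have hk' := part_zero_le_of_hook_le hk
    unfold hookLen at hlt
    omega
  subst hinner
  exact ⟨ho.eq_of_part_eq hl fun i => by simpa [part_nil] using hrow i, rfl⟩

theorem kConj_eq_skewCols {k : ℕ} {l : List ℕ} (hl : IsPartition l)
    (hk : part l 0 + l.length - 1 ≤ k) : kConj k l = skewCols l [] := by
  have hex : ∃ p : List ℕ × List ℕ, IsKSkew k l p.1 p.2 := ⟨(l, []), isKSkew_self hl hk⟩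
  obtain ⟨h₁, h₂⟩ := hex.choose_spec.eq_of_hook_le hl hk
  rw [kConj, dif_pos hex, h₁, h₂]

theorem part_skewCols_nil {l : List ℕ} (hl : IsPartition l) (j : ℕ) :
    part (skewCols l []) j = colLen l [] j := by
  have hfilter : skewCols l [] = (List.range (part l 0)).map (colLen l []) := by
    rw [skewCols, List.filter_eq_self]
    simp only [List.mem_map, List.mem_range, decide_eq_true_eq]
    rintro _ ⟨i, hi, rfl⟩
    refine Finset.card_ne_zero_of_mem (a := 0) ?_
    simp only [Finset.mem_filter, Finset.mem_range, part_nil]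
    exact ⟨(hl.part_pos_iff 0).mp (by omega), Nat.zero_le _, hi⟩
  rw [hfilter]
  rcases lt_or_ge j (part l 0) with hj | hj
  · rw [part_of_lt (by simpa using hj)]
    simp
  · rw [part_of_length_le (by simpa using hj), colLen, eq_comm, Finset.card_eq_zero,
      Finset.filter_eq_empty_iff]
    intro i _ hi
    have := hl.part_antitone (Nat.zero_le i)
    omega

theorem SubDiag.colLen_le {l m : List ℕ} (hl : IsPartition l) (h : SubDiag l m) (j : ℕ) :
    colLen l [] j ≤ colLen m [] j := by
  refine Finset.card_le_card fun i hi => ?_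
  simp only [Finset.mem_filter, Finset.mem_range, part_nil] at hi ⊢
  exact ⟨hi.1.trans_le (h.length_le hl), hi.2.1, hi.2.2.trans_le (h i)⟩

theorem KLe.subDiag {k : ℕ} {l m : List ℕ} (h : KLe k l m) : SubDiag l m := by
  induction h with
  | refl => exact fun _ => le_rfl
  | tail _ hc ih => exact ih.trans hc.2.2.1

/-- A cover in Young's lattice between shapes with corner hook at most `k` is a cover in the
`k`-Young order. -/
theorem SubDiag.kCover {k : ℕ} {l m : List ℕ} (hl : IsPartition l) (hm : IsPartition m)
    (hk : part m 0 + m.length - 1 ≤ k) (h : SubDiag l m) (hsum : m.sum = l.sum + 1) :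
    KCover k l m := by
  have hkl : part l 0 + l.length - 1 ≤ k := by
    have h₁ := h 0
    have h₂ := h.length_le hl
    omega
  refine ⟨⟨hl, part_zero_le_of_hook_le hkl⟩, ⟨hm, part_zero_le_of_hook_le hk⟩, h, ?_, hsum⟩
  intro j
  rw [kConj_eq_skewCols hl hkl, kConj_eq_skewCols hm hk, part_skewCols_nil hl,
    part_skewCols_nil hm]
  exact h.colLen_le hl j

theorem SubDiag.kLe {k : ℕ} {l m : List ℕ} (hl : IsPartition l) (hm : IsPartition m)
    (hk : part m 0 + m.length - 1 ≤ k) (h : SubDiag l m) : KLe k l m := by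
  induction hn : m.sum - l.sum generalizing l with
  | zero =>
    by_cases hne : l = m
    · exact hne ▸ Relation.ReflTransGen.refl
    · obtain ⟨r, hr, -, hrm, hsum⟩ := h.exists_cover hl hm hne
      have := hrm.sum_le hr
      omega
  | succ n ih =>
    have hne : l ≠ m := by
      rintro rfl
      omega
    obtain ⟨r, hr, hlr, hrm, hsum⟩ := h.exists_cover hl hm hne
    have hkr : part r 0 + r.length - 1 ≤ k := by
      have h₁ := hrm 0
      have h₂ := hrm.length_le hr
      omega
    exact Relation.ReflTransGen.head (hlr.kCover hl hr hkr hsum) (ih hr hrm (by omega))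

/-- if the corner hook of `λ` is at most `k` (`λ₁ + ℓ(λ) - 1 ≤ k`), then
the `k`-Young order below `λ` coincides with Young's lattice: for partitions `μ` and
`ν ⊆ λ`, `μ ≼ ν` in the `k`-Young order iff `μ ⊆ ν`. -/
theorem kYoung_ideal_eq_young (k : ℕ) (lam : List ℕ) (hlam : IsPartition lam)
    (hhook : part lam 0 + lam.length - 1 ≤ k) (μ ν : List ℕ)
    (hμ : IsPartition μ) (hν : IsPartition ν) (hνlam : SubDiag ν lam) :
    KLe k μ ν ↔ SubDiag μ ν := by
  refine ⟨KLe.subDiag, SubDiag.kLe hμ hν ?_⟩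
  have h₁ := hνlam 0
  have h₂ := hνlam.length_le hν
  omega
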